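/- Let m, Assumption 1, the curve data (γ, ν, κ, θ₀, θ), the tubular data (I, Φ, Ω) with Assumption 2, the operator U and the transformed operator H^E_ε be as in the context, let ε > 0, and let ψ be a classical solution of the Dirac equation. Let χ ∈ C^∞(ℝ²,[0,1]) satisfy χ(x) = 1 whenever dist(x,E) < 1/(4‖κ‖_∞) and χ(x) = 0 whenever dist(x,E) > 1/(2‖κ‖_∞). Define φ(t,s,y) := (U(χ · ψ(t,·)))(s,y) for t ∈ ℝ and (s,y) ∈ ℝ × I. Then φ solves the transformed Dirac equation on the half-width tube: for all t ∈ ℝ and all (s,y) with |y| < 1/(4‖κ‖_∞), iε ∂_t φ(t,s,y) = (H^E_ε φ(t,·,·))(s,y). -/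

import Mathlib

open MeasureTheory Complex

noncomputable section

abbrev C2 := Fin 2 → ℂ

def pauli1 : Matrix (Fin 2) (Fin 2) ℂ := !![0, 1; 1, 0]
def pauli2 : Matrix (Fin 2) (Fin 2) ℂ := !![0, -Complex.I; Complex.I, 0]
def pauli3 : Matrix (Fin 2) (Fin 2) ℂ := !![1, 0; 0, -1]

def enorm2 (v : ℝ × ℝ) : ℝ := Real.sqrt (v.1 ^ 2 + v.2 ^ 2)
def perp2 (v : ℝ × ℝ) : ℝ × ℝ := (-v.2, v.1)
def dot2 (v w : ℝ × ℝ) : ℝ := v.1 * w.1 + v.2 * w.2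
def grad2 (m : ℝ × ℝ → ℝ) (x : ℝ × ℝ) : ℝ × ℝ := (fderiv ℝ m x (1, 0), fderiv ℝ m x (0, 1))

def pdx (u : ℝ × ℝ → C2) (x : ℝ × ℝ) : C2 := fderiv ℝ u x (1, 0)
def pdy (u : ℝ × ℝ → C2) (x : ℝ × ℝ) : C2 := fderiv ℝ u x (0, 1)

def diracOp (ε : ℝ) (m : ℝ × ℝ → ℝ) (u : ℝ × ℝ → C2) (x : ℝ × ℝ) : C2 :=
  (m x : ℂ) • pauli3.mulVec (u x)
    - (Complex.I * (ε : ℂ)) • pauli1.mulVec (pdx u x)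
    - (Complex.I * (ε : ℂ)) • pauli2.mulVec (pdy u x)

structure IsClassicalSolution (ε : ℝ) (m : ℝ × ℝ → ℝ) (ψ : ℝ → ℝ × ℝ → C2) : Prop where
  smooth : ContDiff ℝ (⊤ : ℕ∞) (fun p : ℝ × (ℝ × ℝ) => ψ p.1 p.2)
  schwartz : ∀ t : ℝ, ∀ k n : ℕ, ∃ C : ℝ, ∀ x : ℝ × ℝ,
      ‖x‖ ^ k * ‖iteratedFDeriv ℝ n (ψ t) x‖ ≤ C
  l2diff : ∃ F : ℝ → Lp C2 2 (volume : Measure (ℝ × ℝ)),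
      Differentiable ℝ F ∧ ∀ t : ℝ, (F t : ℝ × ℝ → C2) =ᵐ[volume] ψ t
  eqn : ∀ t x, (Complex.I * (ε : ℂ)) • deriv (fun τ => ψ τ x) t = diracOp ε m (ψ t) x

def nuVec (m : ℝ × ℝ → ℝ) (γ : ℝ → ℝ × ℝ) (s : ℝ) : ℝ × ℝ :=
  (enorm2 (grad2 m (γ s)))⁻¹ • grad2 m (γ s)

def curv (m : ℝ × ℝ → ℝ) (γ : ℝ → ℝ × ℝ) (s : ℝ) : ℝ :=
  dot2 (deriv (deriv γ) s) (nuVec m γ s)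

def thetaFun (m : ℝ × ℝ → ℝ) (γ : ℝ → ℝ × ℝ) (θ₀ : ℝ) (s : ℝ) : ℝ :=
  θ₀ + ∫ η in (0:ℝ)..s, curv m γ η

def tubeMap (m : ℝ × ℝ → ℝ) (γ : ℝ → ℝ × ℝ) (p : ℝ × ℝ) : ℝ × ℝ :=
  γ p.1 + p.2 • nuVec m γ p.1

structure CurveData (m : ℝ × ℝ → ℝ) (γ : ℝ → ℝ × ℝ) : Prop where
  smooth : ContDiff ℝ (⊤ : ℕ∞) γ
  grad_ne : ∀ s, grad2 m (γ s) ≠ 0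
  ode : ∀ s, deriv γ s = (enorm2 (grad2 m (γ s)))⁻¹ • (-(perp2 (grad2 m (γ s))))
  start : m (γ 0) = 0

structure TubularData (m : ℝ × ℝ → ℝ) (γ : ℝ → ℝ × ℝ) (K : ℝ) : Prop where
  Ksup : K = sSup (Set.range fun s => |curv m γ s|)
  Kpos : 0 < K
  Kbdd : BddAbove (Set.range fun s => |curv m γ s|)
  inj : Set.InjOn (tubeMap m γ) (Set.univ ×ˢ Set.Ioo (-(1/(2*K))) (1/(2*K)))
  inv : ∃ Ψ : ℝ × ℝ → ℝ × ℝ,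
      ContDiffOn ℝ (⊤ : ℕ∞) Ψ (tubeMap m γ '' (Set.univ ×ˢ Set.Ioo (-(1/(2*K))) (1/(2*K)))) ∧
      ∀ p ∈ Set.univ ×ˢ Set.Ioo (-(1/(2*K))) (1/(2*K)), Ψ (tubeMap m γ p) = p

def uMat (θv : ℝ) : Matrix (Fin 2) (Fin 2) ℂ :=
  !![Complex.exp (Complex.I * ((Real.pi/4 + θv/2 : ℝ) : ℂ)),
     -Complex.exp (-(Complex.I * ((Real.pi/4 + θv/2 : ℝ) : ℂ)));
     Complex.exp (Complex.I * ((Real.pi/4 + θv/2 : ℝ) : ℂ)),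
     Complex.exp (-(Complex.I * ((Real.pi/4 + θv/2 : ℝ) : ℂ)))]

def uOp (m : ℝ × ℝ → ℝ) (γ : ℝ → ℝ × ℝ) (θ₀ : ℝ) (u : ℝ × ℝ → C2) (p : ℝ × ℝ) : C2 :=
  ((Real.sqrt ((1 - p.2 * curv m γ p.1)/2) : ℝ) : ℂ) •
    (uMat (thetaFun m γ θ₀ p.1)).mulVec (u (tubeMap m γ p))

def transOp (ε : ℝ) (m : ℝ × ℝ → ℝ) (γ : ℝ → ℝ × ℝ) (v : ℝ × ℝ → C2) (p : ℝ × ℝ) : C2 :=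
  (m (tubeMap m γ p) : ℂ) • pauli1.mulVec (v p)
  + (Complex.I * (ε : ℂ)) • pauli2.mulVec (pdy v p)
  - (Complex.I * (ε : ℂ) / ((1 - p.2 * curv m γ p.1 : ℝ) : ℂ)) • pauli3.mulVec (pdx v p)
  - (Complex.I * (ε : ℂ) * (p.2 : ℂ) * ((deriv (curv m γ) p.1 : ℝ) : ℂ)
      / ((2 * (1 - p.2 * curv m γ p.1)^2 : ℝ) : ℂ)) • pauli3.mulVec (v p)

/-- Euclidean distance to the interface `E = {m = 0}`. -/
def einfDist (m : ℝ × ℝ → ℝ) (x : ℝ × ℝ) : ℝ := sInf ((fun z => enorm2 (x - z)) '' {z | m z = 0})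

lemma gradSq_pos {v : ℝ × ℝ} (hv : v ≠ 0) : 0 < v.1 ^ 2 + v.2 ^ 2 := by
  by_contra h
  apply hv
  have h1 : v.1 = 0 := by nlinarith [sq_nonneg v.1, sq_nonneg v.2]
  have h2 : v.2 = 0 := by nlinarith [sq_nonneg v.1, sq_nonneg v.2]
  exact Prod.ext h1 h2

lemma hasDeriv_fst {f : ℝ → ℝ × ℝ} {d : ℝ × ℝ} {s : ℝ} (h : HasDerivAt f d s) :
    HasDerivAt (fun s => (f s).1) d.1 s :=
  (ContinuousLinearMap.fst ℝ ℝ ℝ).hasFDerivAt.comp_hasDerivAt s h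

lemma hasDeriv_snd {f : ℝ → ℝ × ℝ} {d : ℝ × ℝ} {s : ℝ} (h : HasDerivAt f d s) :
    HasDerivAt (fun s => (f s).2) d.2 s :=
  (ContinuousLinearMap.snd ℝ ℝ ℝ).hasFDerivAt.comp_hasDerivAt s h

section curve
variable {m : ℝ × ℝ → ℝ} {γ : ℝ → ℝ × ℝ}

lemma grad_smooth (hm : ContDiff ℝ (⊤ : ℕ∞) m) (hc : CurveData m γ) :
    ContDiff ℝ (⊤ : ℕ∞) (fun s => grad2 m (γ s)) := by
  have h1 : ContDiff ℝ (⊤ : ℕ∞) (fderiv ℝ m) := hm.fderiv_right (by simp)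
  have h2 : ContDiff ℝ (⊤ : ℕ∞) (fun s => fderiv ℝ m (γ s)) := h1.comp hc.smooth
  unfold grad2
  exact (h2.clm_apply contDiff_const).prodMk (h2.clm_apply contDiff_const)

lemma nu_smooth (hm : ContDiff ℝ (⊤ : ℕ∞) m) (hc : CurveData m γ) :
    ContDiff ℝ (⊤ : ℕ∞) (nuVec m γ) := by
  have hg := grad_smooth hm hc
  unfold nuVec
  have hp := fun s => gradSq_pos (hc.grad_ne s)
  refine ContDiff.smul (f := fun s => (enorm2 (grad2 m (γ s)))⁻¹) (ContDiff.inv ?_ ?_) hg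
  · unfold enorm2
    exact ContDiff.sqrt ((hg.fst.pow 2).add (hg.snd.pow 2)) (fun s => (hp s).ne')
  · intro s
    exact (Real.sqrt_pos.2 (hp s)).ne'

lemma nu_sq (hc : CurveData m γ) (s : ℝ) :
    (nuVec m γ s).1 ^ 2 + (nuVec m γ s).2 ^ 2 = 1 := by
  have hp := gradSq_pos (hc.grad_ne s)
  have h0 : enorm2 (grad2 m (γ s)) ≠ 0 := (Real.sqrt_pos.2 hp).ne'
  have h1 : enorm2 (grad2 m (γ s)) ^ 2 = (grad2 m (γ s)).1 ^ 2 + (grad2 m (γ s)).2 ^ 2 :=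
    Real.sq_sqrt hp.le
  simp only [nuVec, Prod.smul_fst, Prod.smul_snd, smul_eq_mul]
  field_simp
  linarith

lemma dgamma (hc : CurveData m γ) (s : ℝ) :
    deriv γ s = ((nuVec m γ s).2, -(nuVec m γ s).1) := by
  rw [hc.ode s]
  ext <;> simp [nuVec, perp2]

lemma hasDeriv_gamma (hc : CurveData m γ) (s : ℝ) :
    HasDerivAt γ ((nuVec m γ s).2, -(nuVec m γ s).1) s := by
  rw [← dgamma hc s]
  exact (hc.smooth.differentiable (by simp) s).hasDerivAt

lemma curv_smooth (hm : ContDiff ℝ (⊤ : ℕ∞) m) (hc : CurveData m γ) :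
    ContDiff ℝ (⊤ : ℕ∞) (curv m γ) := by
  have hn := nu_smooth hm hc
  have h1 : ContDiff ℝ (⊤ : ℕ∞) (deriv γ) := by
    have : deriv γ = fun s => ((nuVec m γ s).2, -(nuVec m γ s).1) := funext (dgamma hc)
    rw [this]
    exact hn.snd.prodMk hn.fst.neg
  have h2 : ContDiff ℝ (⊤ : ℕ∞) (deriv (deriv γ)) := by
    have := (contDiff_infty_iff_deriv (𝕜 := ℝ) (f := deriv γ)).1 h1
    exact this.2
  unfold curv dot2
  exact (h2.fst.mul hn.fst).add (h2.snd.mul hn.snd)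

lemma hasDeriv_nu (hm : ContDiff ℝ (⊤ : ℕ∞) m) (hc : CurveData m γ) (s : ℝ) :
    HasDerivAt (nuVec m γ)
      (-(curv m γ s * (nuVec m γ s).2), curv m γ s * (nuVec m γ s).1) s := by
  have hd : HasDerivAt (nuVec m γ) (deriv (nuVec m γ) s) s :=
    ((nu_smooth hm hc).differentiable (by simp) s).hasDerivAt
  have h1 : HasDerivAt (fun s => (nuVec m γ s).1) (deriv (nuVec m γ) s).1 s :=
    hasDeriv_fst hd
  have h2 : HasDerivAt (fun s => (nuVec m γ s).2) (deriv (nuVec m γ) s).2 s :=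
    hasDeriv_snd hd
  have h3 : deriv (deriv γ) s = ((deriv (nuVec m γ) s).2, -(deriv (nuVec m γ) s).1) := by
    have : deriv γ = fun s => ((nuVec m γ s).2, -(nuVec m γ s).1) := funext (dgamma hc)
    rw [this]
    exact (h2.prodMk h1.neg).deriv
  have h4 := ((h1.pow 2).add (h2.pow 2))
  have h5 : ((fun s => (nuVec m γ s).1) ^ 2 + (fun s => (nuVec m γ s).2) ^ 2) = fun _ => (1:ℝ) :=
    funext (fun s => nu_sq hc s)
  rw [h5] at h4
  have h6 := h4.unique (hasDerivAt_const s (1:ℝ))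
  have h7 := nu_sq hc s
  have hk : curv m γ s = (deriv (nuVec m γ) s).2 * (nuVec m γ s).1
      - (deriv (nuVec m γ) s).1 * (nuVec m γ s).2 := by
    simp only [curv, dot2, h3]; ring
  simp only [Nat.cast_ofNat, Nat.add_one_sub_one, pow_one] at h6
  convert hd using 1
  ext
  · simp only [hk]
    linear_combination (deriv (nuVec m γ) s).1 * h7 - (nuVec m γ s).1 * h6 / 2
  · simp only [hk]
    linear_combination (deriv (nuVec m γ) s).2 * h7 - (nuVec m γ s).2 * h6 / 2

lemma hasDeriv_theta (hm : ContDiff ℝ (⊤ : ℕ∞) m) (hc : CurveData m γ) (θ₀ s : ℝ) :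
    HasDerivAt (thetaFun m γ θ₀) (curv m γ s) s := by
  have hk := (curv_smooth hm hc).continuous
  exact (intervalIntegral.integral_hasDerivAt_right (hk.intervalIntegrable _ _)
    (hk.stronglyMeasurableAtFilter _ _) hk.continuousAt).const_add θ₀

lemma nu_theta (hm : ContDiff ℝ (⊤ : ℕ∞) m) (hc : CurveData m γ) (θ₀ : ℝ)
    (hν₀ : nuVec m γ 0 = (Real.cos θ₀, Real.sin θ₀)) (s : ℝ) :
    (nuVec m γ s).1 = Real.cos (thetaFun m γ θ₀ s) ∧
    (nuVec m γ s).2 = Real.sin (thetaFun m γ θ₀ s) := by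
  have h1 : ∀ s, HasDerivAt (fun s => (nuVec m γ s).1) (-(curv m γ s * (nuVec m γ s).2)) s :=
    fun s => hasDeriv_fst (hasDeriv_nu hm hc s)
  have h2 : ∀ s, HasDerivAt (fun s => (nuVec m γ s).2) (curv m γ s * (nuVec m γ s).1) s :=
    fun s => hasDeriv_snd (hasDeriv_nu hm hc s)
  have hcos := fun s => (hasDeriv_theta hm hc θ₀ s).cos
  have hsin := fun s => (hasDeriv_theta hm hc θ₀ s).sin
  have hf := fun s => ((h1 s).mul (hcos s)).add ((h2 s).mul (hsin s))
  have hg := fun s => ((h2 s).mul (hcos s)).sub ((h1 s).mul (hsin s))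
  have h0 : thetaFun m γ θ₀ 0 = θ₀ := by simp [thetaFun]
  have cf := is_const_of_deriv_eq_zero (fun s => (hf s).differentiableAt)
    (fun s => by rw [(hf s).deriv]; ring) s 0
  have cg := is_const_of_deriv_eq_zero (fun s => (hg s).differentiableAt)
    (fun s => by rw [(hg s).deriv]; ring) s 0
  simp only [Pi.add_apply, Pi.mul_apply, Pi.sub_apply, h0, hν₀] at cf cg
  have e0 := Real.sin_sq_add_cos_sq θ₀
  have e1 := Real.sin_sq_add_cos_sq (thetaFun m γ θ₀ s)
  set C := Real.cos (thetaFun m γ θ₀ s)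
  set S := Real.sin (thetaFun m γ θ₀ s)
  constructor
  · linear_combination C * cf - S * cg + C * e0 - (nuVec m γ s).1 * e1
  · linear_combination S * cf + C * cg + S * e0 - (nuVec m γ s).2 * e1

lemma m_gamma (hm : ContDiff ℝ (⊤ : ℕ∞) m) (hc : CurveData m γ) (s : ℝ) : m (γ s) = 0 := by
  have hd : ∀ s, HasDerivAt (fun s => m (γ s)) 0 s := by
    intro s
    have h := ((hm.differentiable (by simp) (γ s)).hasFDerivAt).comp_hasDerivAt s
      (hasDeriv_gamma hc s)
    have hz : fderiv ℝ m (γ s) ((nuVec m γ s).2, -(nuVec m γ s).1) = 0 := ?_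
    · rw [hz] at h
      exact h
    have : ((nuVec m γ s).2, -(nuVec m γ s).1)
      = (nuVec m γ s).2 • ((1:ℝ), (0:ℝ)) + (-(nuVec m γ s).1) • ((0:ℝ), (1:ℝ)) := by ext <;> simp
    rw [this, map_add, map_smul, map_smul]
    simp only [nuVec, grad2, Prod.smul_fst, Prod.smul_snd, smul_eq_mul]
    ring
  rw [is_const_of_deriv_eq_zero (fun s => (hd s).differentiableAt) (fun s => (hd s).deriv) s 0]
  exact hc.start

lemma dist_tube (hm : ContDiff ℝ (⊤ : ℕ∞) m) (hc : CurveData m γ) (p : ℝ × ℝ) :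
    einfDist m (tubeMap m γ p) ≤ |p.2| := by
  unfold einfDist
  refine csInf_le ⟨0, ?_⟩ ⟨γ p.1, m_gamma hm hc p.1, ?_⟩
  · rintro _ ⟨z, _, rfl⟩
    exact Real.sqrt_nonneg _
  · simp only [tubeMap, add_sub_cancel_left, enorm2, Prod.smul_fst, Prod.smul_snd, smul_eq_mul]
    rw [← Real.sqrt_sq_eq_abs]
    congr 1
    linear_combination p.2 ^ 2 * nu_sq hc p.1

lemma tube_smooth (hm : ContDiff ℝ (⊤ : ℕ∞) m) (hc : CurveData m γ) :
    ContDiff ℝ (⊤ : ℕ∞) (tubeMap m γ) :=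
  (hc.smooth.comp contDiff_fst).add (contDiff_snd.smul ((nu_smooth hm hc).comp contDiff_fst))

/-- Component of the phase matrix times a vector. -/
lemma uMat_mulVec (θ : ℝ) (v : C2) : (uMat θ).mulVec v =
    ![Complex.exp (Complex.I * ((Real.pi/4 + θ/2 : ℝ) : ℂ)) * v 0
      - Complex.exp (-(Complex.I * ((Real.pi/4 + θ/2 : ℝ) : ℂ))) * v 1,
      Complex.exp (Complex.I * ((Real.pi/4 + θ/2 : ℝ) : ℂ)) * v 0
      + Complex.exp (-(Complex.I * ((Real.pi/4 + θ/2 : ℝ) : ℂ))) * v 1] := by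
  ext i
  fin_cases i <;> simp [uMat, Matrix.mulVec, dotProduct, Fin.sum_univ_two, sub_eq_add_neg]

lemma phase_rel (θ : ℝ) :
    Complex.exp (-(Complex.I * ((Real.pi/4 + θ/2 : ℝ) : ℂ))) *
      ((Real.cos θ : ℂ) + Complex.I * (Real.sin θ : ℂ))
      = - Complex.I * Complex.exp (Complex.I * ((Real.pi/4 + θ/2 : ℝ) : ℂ)) ∧
    Complex.exp (Complex.I * ((Real.pi/4 + θ/2 : ℝ) : ℂ)) *
      ((Real.cos θ : ℂ) - Complex.I * (Real.sin θ : ℂ))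
      = Complex.I * Complex.exp (-(Complex.I * ((Real.pi/4 + θ/2 : ℝ) : ℂ))) := by
  have e1 : (Real.cos θ : ℂ) + Complex.I * (Real.sin θ : ℂ) = Complex.exp (θ * Complex.I) := by
    rw [Complex.exp_mul_I]; push_cast; ring
  have e2 : (Real.cos θ : ℂ) - Complex.I * (Real.sin θ : ℂ) = Complex.exp (-θ * Complex.I) := by
    rw [Complex.exp_mul_I]; simp; ring
  have e3 : Complex.I = Complex.exp (Real.pi / 2 * Complex.I) := Complex.exp_pi_div_two_mul_I.symm
  have e4 : -Complex.I = Complex.exp (-Real.pi / 2 * Complex.I) :=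
    Complex.exp_neg_pi_div_two_mul_I.symm
  constructor
  · rw [e1, e4, ← Complex.exp_add, ← Complex.exp_add]
    congr 1; push_cast; ring
  · rw [e2]
    conv_rhs => rw [show ∀ z, Complex.I * Complex.exp z = Complex.exp (Real.pi / 2 * Complex.I) * Complex.exp z from fun z => by rw [← e3]]
    rw [← Complex.exp_add, ← Complex.exp_add]
    congr 1; push_cast; ring

lemma hasDeriv_exp (Θ : ℝ → ℝ) (Θ' r : ℝ) (hΘ : HasDerivAt Θ Θ' r) :
    HasDerivAt (fun r => Complex.exp (Complex.I * ((Real.pi/4 + Θ r/2 : ℝ) : ℂ)))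
      (Complex.exp (Complex.I * ((Real.pi/4 + Θ r/2 : ℝ) : ℂ)) * (Complex.I * (Θ' / 2 : ℂ))) r ∧
    HasDerivAt (fun r => Complex.exp (-(Complex.I * ((Real.pi/4 + Θ r/2 : ℝ) : ℂ))))
      (Complex.exp (-(Complex.I * ((Real.pi/4 + Θ r/2 : ℝ) : ℂ))) *
        (-(Complex.I * (Θ' / 2 : ℂ)))) r := by
  have h : HasDerivAt (fun r => Complex.I * ((Real.pi/4 + Θ r/2 : ℝ) : ℂ))
      (Complex.I * (Θ' / 2 : ℂ)) r := by
    have := (((hΘ.div_const 2).const_add (Real.pi/4)).ofReal_comp).const_mul Complex.I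
    simpa using this
  exact ⟨h.cexp, h.neg.cexp⟩

lemma hasDeriv_line (c Θ : ℝ → ℝ) (V : ℝ → C2) (c' Θ' : ℝ) (V' : C2) (r : ℝ)
    (hc : HasDerivAt c c' r) (hΘ : HasDerivAt Θ Θ' r) (hV : HasDerivAt V V' r) :
    HasDerivAt (fun r => ((c r : ℝ) : ℂ) • (uMat (Θ r)).mulVec (V r))
      ((c' : ℂ) • (uMat (Θ r)).mulVec (V r) + (c r : ℂ) • (uMat (Θ r)).mulVec V'
        + (c r * (Complex.I * (Θ' / 2)) : ℂ) • pauli1.mulVec ((uMat (Θ r)).mulVec (V r))) r := by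
  obtain ⟨ha, hb⟩ := hasDeriv_exp Θ Θ' r hΘ
  have hc' : HasDerivAt (fun r => (c r : ℂ)) (c' : ℂ) r := hc.ofReal_comp
  have hV' := hasDerivAt_pi.1 hV
  simp only [uMat_mulVec]
  rw [hasDerivAt_pi]
  intro i
  fin_cases i
  · refine (hc'.mul ((ha.mul (hV' 0)).sub (hb.mul (hV' 1)))).congr_deriv ?_
    simp [pauli1, Matrix.mulVec, dotProduct, Fin.sum_univ_two]
    ring
  · refine (hc'.mul ((ha.mul (hV' 0)).add (hb.mul (hV' 1)))).congr_deriv ?_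
    simp [pauli1, Matrix.mulVec, dotProduct, Fin.sum_univ_two]
    ring

lemma uOp_diff (hm : ContDiff ℝ (⊤ : ℕ∞) m) (hc : CurveData m γ) (θ₀ : ℝ) (u : ℝ × ℝ → C2)
    (hu : ContDiff ℝ (⊤ : ℕ∞) u) (p : ℝ × ℝ) (hJ : 0 < 1 - p.2 * curv m γ p.1) :
    DifferentiableAt ℝ (uOp m γ θ₀ u) p := by
  have hΘ : DifferentiableAt ℝ (fun p : ℝ × ℝ => thetaFun m γ θ₀ p.1) p :=
    (hasDeriv_theta hm hc θ₀ p.1).differentiableAt.comp p differentiableAt_fst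
  have hk : DifferentiableAt ℝ (fun p : ℝ × ℝ => curv m γ p.1) p :=
    ((curv_smooth hm hc).differentiable (by simp) p.1).comp p differentiableAt_fst
  have hc0 : DifferentiableAt ℝ (fun p : ℝ × ℝ => Real.sqrt ((1 - p.2 * curv m γ p.1)/2)) p := by
    refine DifferentiableAt.sqrt ?_ (by positivity)
    fun_prop
  have hc1 : DifferentiableAt ℝ
      (fun p : ℝ × ℝ => ((Real.sqrt ((1 - p.2 * curv m γ p.1)/2) : ℝ) : ℂ)) p :=
    Complex.ofRealCLM.differentiableAt.comp p hc0
  have hp : DifferentiableAt ℝ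
      (fun p : ℝ × ℝ => ((Real.pi/4 + thetaFun m γ θ₀ p.1/2 : ℝ) : ℂ)) p :=
    Complex.ofRealCLM.differentiableAt.comp p
      (show DifferentiableAt ℝ (fun p : ℝ × ℝ => Real.pi/4 + thetaFun m γ θ₀ p.1/2) p by fun_prop)
  have ha : DifferentiableAt ℝ (fun p : ℝ × ℝ => Complex.exp
      (Complex.I * ((Real.pi/4 + thetaFun m γ θ₀ p.1/2 : ℝ) : ℂ))) p :=
    (hp.const_mul Complex.I).cexp
  have hb : DifferentiableAt ℝ (fun p : ℝ × ℝ => Complex.exp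
      (-(Complex.I * ((Real.pi/4 + thetaFun m γ θ₀ p.1/2 : ℝ) : ℂ)))) p :=
    (hp.const_mul Complex.I).neg.cexp
  have hV : DifferentiableAt ℝ (fun p => u (tubeMap m γ p)) p :=
    (hu.comp (tube_smooth hm hc)).differentiable (by simp) p
  have hV' := differentiableAt_pi.1 hV
  rw [differentiableAt_pi]
  intro i
  unfold uOp
  simp only [uMat_mulVec]
  fin_cases i
  · exact hc1.mul ((ha.mul (hV' 0)).sub (hb.mul (hV' 1)))
  · exact hc1.mul ((ha.mul (hV' 0)).add (hb.mul (hV' 1)))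

lemma fderiv_split (u : ℝ × ℝ → C2) (x : ℝ × ℝ) (a b : ℝ) :
    fderiv ℝ u x (a, b) = (a : ℂ) • pdx u x + (b : ℂ) • pdy u x := by
  have : (a, b) = a • ((1:ℝ), (0:ℝ)) + b • ((0:ℝ), (1:ℝ)) := by ext <;> simp
  rw [this, map_add, map_smul, map_smul]
  ext i
  simp [pdx, pdy]

lemma uOp_pdx (hm : ContDiff ℝ (⊤ : ℕ∞) m) (hc : CurveData m γ) (θ₀ : ℝ) (u : ℝ × ℝ → C2)
    (hu : ContDiff ℝ (⊤ : ℕ∞) u) (s y : ℝ) (hJ : 0 < 1 - y * curv m γ s) :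
    pdx (uOp m γ θ₀ u) (s, y) =
      ((Real.sqrt ((1 - y * curv m γ s)/2) * (-(y * deriv (curv m γ) s) / (2 * (1 - y * curv m γ s))) : ℝ) : ℂ) •
        (uMat (thetaFun m γ θ₀ s)).mulVec (u (tubeMap m γ (s, y)))
      + (Real.sqrt ((1 - y * curv m γ s)/2) : ℂ) • (uMat (thetaFun m γ θ₀ s)).mulVec
        ((((1 - y * curv m γ s) * (nuVec m γ s).2 : ℝ) : ℂ) • pdx u (tubeMap m γ (s, y))
        + ((-((1 - y * curv m γ s) * (nuVec m γ s).1) : ℝ) : ℂ) • pdy u (tubeMap m γ (s, y)))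
      + (Real.sqrt ((1 - y * curv m γ s)/2) * (Complex.I * (curv m γ s / 2)) : ℂ) •
        pauli1.mulVec ((uMat (thetaFun m γ θ₀ s)).mulVec (u (tubeMap m γ (s, y)))) := by
  have hd := (uOp_diff hm hc θ₀ u hu (s, y) hJ).hasFDerivAt
  have hline : HasDerivAt (fun r : ℝ => (r, y)) ((1:ℝ), (0:ℝ)) s :=
    (hasDerivAt_id s).prodMk (hasDerivAt_const s y)
  have h1 := HasFDerivAt.comp_hasDerivAt s hd hline
  have hk : HasDerivAt (curv m γ) (deriv (curv m γ) s) s :=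
    ((curv_smooth hm hc).differentiable (by simp) s).hasDerivAt
  have hcc : HasDerivAt (fun r => Real.sqrt ((1 - y * curv m γ r)/2))
      (Real.sqrt ((1 - y * curv m γ s)/2) * (-(y * deriv (curv m γ) s) / (2 * (1 - y * curv m γ s)))) s := by
    have hpos : 0 < (1 - y * curv m γ s)/2 := by positivity
    refine ((((hk.const_mul y).const_sub 1).div_const 2).sqrt hpos.ne').congr_deriv ?_
    have h0 := Real.sqrt_pos.2 hpos
    have h2 := Real.sq_sqrt hpos.le
    set R := Real.sqrt ((1 - y * curv m γ s)/2)
    have h3 : 1 - y * curv m γ s = 2 * R ^ 2 := by linarith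
    rw [h3]
    field_simp
    try ring
  have hT : HasDerivAt (fun r => tubeMap m γ (r, y))
      ((1 - y * curv m γ s) * (nuVec m γ s).2, -((1 - y * curv m γ s) * (nuVec m γ s).1)) s := by
    refine ((hasDeriv_gamma hc s).add ((hasDeriv_nu hm hc s).const_smul y)).congr_deriv ?_
    ext <;> simp <;> ring
  have hV := HasFDerivAt.comp_hasDerivAt s
    ((hu.differentiable (by simp) (tubeMap m γ (s, y))).hasFDerivAt) hT
  rw [fderiv_split] at hV
  exact h1.unique (hasDeriv_line _ _ _ _ _ _ s hcc (hasDeriv_theta hm hc θ₀ s) hV)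

lemma uOp_pdy (hm : ContDiff ℝ (⊤ : ℕ∞) m) (hc : CurveData m γ) (θ₀ : ℝ) (u : ℝ × ℝ → C2)
    (hu : ContDiff ℝ (⊤ : ℕ∞) u) (s y : ℝ) (hJ : 0 < 1 - y * curv m γ s) :
    pdy (uOp m γ θ₀ u) (s, y) =
      ((Real.sqrt ((1 - y * curv m γ s)/2) * (-(curv m γ s) / (2 * (1 - y * curv m γ s))) : ℝ) : ℂ) •
        (uMat (thetaFun m γ θ₀ s)).mulVec (u (tubeMap m γ (s, y)))
      + (Real.sqrt ((1 - y * curv m γ s)/2) : ℂ) • (uMat (thetaFun m γ θ₀ s)).mulVec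
        (((nuVec m γ s).1 : ℂ) • pdx u (tubeMap m γ (s, y))
        + ((nuVec m γ s).2 : ℂ) • pdy u (tubeMap m γ (s, y))) := by
  have hd := (uOp_diff hm hc θ₀ u hu (s, y) hJ).hasFDerivAt
  have hline : HasDerivAt (fun r : ℝ => (s, r)) ((0:ℝ), (1:ℝ)) y :=
    (hasDerivAt_const y s).prodMk (hasDerivAt_id y)
  have h1 := HasFDerivAt.comp_hasDerivAt y hd hline
  have hcc : HasDerivAt (fun r => Real.sqrt ((1 - r * curv m γ s)/2))
      (Real.sqrt ((1 - y * curv m γ s)/2) * (-(curv m γ s) / (2 * (1 - y * curv m γ s)))) y := by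
    have hpos : 0 < (1 - y * curv m γ s)/2 := by positivity
    refine (((((hasDerivAt_id y).mul_const (curv m γ s)).const_sub 1).div_const 2).sqrt
      hpos.ne').congr_deriv ?_
    have h0 := Real.sqrt_pos.2 hpos
    have h2 := Real.sq_sqrt hpos.le
    simp only [id]
    set R := Real.sqrt ((1 - y * curv m γ s)/2)
    have h3 : 1 - y * curv m γ s = 2 * R ^ 2 := by linarith
    rw [h3]
    field_simp
    try ring
  have hT : HasDerivAt (fun r => tubeMap m γ (s, r))
      ((nuVec m γ s).1, (nuVec m γ s).2) y := by
    refine (((hasDerivAt_id y).smul_const (nuVec m γ s)).const_add (γ s)).congr_deriv ?_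
    ext <;> simp
  have hV := HasFDerivAt.comp_hasDerivAt y
    ((hu.differentiable (by simp) (tubeMap m γ (s, y))).hasFDerivAt) hT
  rw [fderiv_split] at hV
  have := h1.unique (hasDeriv_line _ _ _ _ _ _ y hcc
    (hasDerivAt_const y (thetaFun m γ θ₀ s)) hV)
  refine Eq.trans this ?_
  simp

/-- The intertwining identity `U H = H^E U` on the tube. -/
lemma intertwine (hm : ContDiff ℝ (⊤ : ℕ∞) m) (hc : CurveData m γ) (θ₀ : ℝ)
    (hν₀ : nuVec m γ 0 = (Real.cos θ₀, Real.sin θ₀)) (ε : ℝ) (u : ℝ × ℝ → C2)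
    (hu : ContDiff ℝ (⊤ : ℕ∞) u) (s y : ℝ) (hJ : 0 < 1 - y * curv m γ s) :
    uOp m γ θ₀ (diracOp ε m u) (s, y) = transOp ε m γ (uOp m γ θ₀ u) (s, y) := by
  unfold transOp
  rw [uOp_pdx hm hc θ₀ u hu s y hJ, uOp_pdy hm hc θ₀ u hu s y hJ]
  obtain ⟨hb, ha⟩ := phase_rel (thetaFun m γ θ₀ s)
  obtain ⟨hn1, hn2⟩ := nu_theta hm hc θ₀ hν₀ s
  rw [← hn1, ← hn2] at ha hb
  have hJ' : (1 : ℂ) - y * curv m γ s ≠ 0 := by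
    have := hJ.ne'
    exact_mod_cast this
  simp only [uOp, uMat_mulVec]
  generalize Real.sqrt ((1 - y * curv m γ s)/2) = c
  generalize Complex.exp (Complex.I * ((Real.pi/4 + thetaFun m γ θ₀ s/2 : ℝ) : ℂ)) = a at *
  generalize Complex.exp (-(Complex.I * ((Real.pi/4 + thetaFun m γ θ₀ s/2 : ℝ) : ℂ))) = b at *
  unfold diracOp
  generalize m (tubeMap m γ (s, y)) = m0
  generalize pdx u (tubeMap m γ (s, y)) = A
  generalize pdy u (tubeMap m γ (s, y)) = B
  generalize u (tubeMap m γ (s, y)) = w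
  generalize (nuVec m γ s).1 = n1 at *
  generalize (nuVec m γ s).2 = n2 at *
  generalize deriv (curv m γ) s = k' at *
  generalize curv m γ s = k at *
  have hI := Complex.I_sq
  ext i
  fin_cases i
  · simp [pauli1, pauli2, pauli3, Matrix.vecHead, Matrix.vecTail, dotProduct, Fin.sum_univ_two]
    generalize (1 : ℂ) - y * k = J at *
    field_simp
    linear_combination (norm := skip) -(2 * ε * c * J ^ 2) * (A 0 * ha + A 1 * hb
      + Complex.I * B 0 * ha - Complex.I * B 1 * hb)
    ring_nf
    simp only [hI]
    ring
  · simp [pauli1, pauli2, pauli3, Matrix.vecHead, Matrix.vecTail, dotProduct, Fin.sum_univ_two]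
    generalize (1 : ℂ) - y * k = J at *
    field_simp
    linear_combination (norm := skip) (2 * ε * c * J ^ 2) * (A 0 * ha - A 1 * hb
      + Complex.I * B 0 * ha + Complex.I * B 1 * hb)
    ring_nf
    simp only [hI]
    ring

end curve

/-- the localized and transformed solution `φ = U(χ ψ)` solves the
transformed Dirac equation on the half-width tube. -/
theorem stmt3
    (m : ℝ × ℝ → ℝ) (hm : ContDiff ℝ (⊤ : ℕ∞) m)
    (hmb : ∀ n : ℕ, ∃ C : ℝ, ∀ x, ‖iteratedFDeriv ℝ n m x‖ ≤ C)
    (hass1 : ∃ c > (0:ℝ), ∀ x, m x = 0 → c ≤ enorm2 (grad2 m x))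
    (γ : ℝ → ℝ × ℝ) (hcurve : CurveData m γ)
    (θ₀ : ℝ) (hθ₀ : θ₀ ∈ Set.Ico 0 (2 * Real.pi))
    (hν₀ : nuVec m γ 0 = (Real.cos θ₀, Real.sin θ₀))
    (K : ℝ) (htube : TubularData m γ K)
    (ε : ℝ) (hε : 0 < ε)
    (ψ : ℝ → ℝ × ℝ → C2) (hψ : IsClassicalSolution ε m ψ)
    (χ : ℝ × ℝ → ℝ) (hχ : ContDiff ℝ (⊤ : ℕ∞) χ) (hχ01 : ∀ x, χ x ∈ Set.Icc (0:ℝ) 1)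
    (hχ1 : ∀ x, einfDist m x < 1/(4*K) → χ x = 1)
    (hχ0 : ∀ x, 1/(2*K) < einfDist m x → χ x = 0)
    (φ : ℝ → ℝ × ℝ → C2)
    (hφ : ∀ t p, φ t p = uOp m γ θ₀ (fun x => (χ x : ℂ) • ψ t x) p) :
    ∀ t s y, |y| < 1/(4*K) →
      (Complex.I * (ε : ℂ)) • deriv (fun τ => φ τ (s, y)) t = transOp ε m γ (φ t) (s, y) := by
  intro t s y hy
  have hKp := htube.Kpos
  have hkK : |curv m γ s| ≤ K := by
    rw [htube.Ksup]
    exact le_csSup htube.Kbdd ⟨s, rfl⟩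
  have hJ : 0 < 1 - y * curv m γ s := by
    have h1 : |y * curv m γ s| ≤ 1/(4*K) * K := by
      rw [abs_mul]
      exact mul_le_mul hy.le hkK (abs_nonneg _) (by positivity)
    have h2 : 1/(4*K) * K = 1/4 := by field_simp
    have h3 := le_abs_self (y * curv m γ s)
    linarith
  have hu : ∀ t, ContDiff ℝ (⊤ : ℕ∞) (ψ t) := fun t =>
    hψ.smooth.comp (contDiff_const.prodMk contDiff_id)
  have hloc : ∀ τ, ∀ p : ℝ × ℝ, |p.2| < 1/(4*K) → φ τ p = uOp m γ θ₀ (ψ τ) p := by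
    intro τ p hp
    rw [hφ]
    unfold uOp
    beta_reduce
    rw [hχ1 _ ((dist_tube hm hcurve p).trans_lt hp)]
    simp
  have hev : φ t =ᶠ[nhds (s, y)] uOp m γ θ₀ (ψ t) := by
    have hopen : IsOpen {p : ℝ × ℝ | |p.2| < 1/(4*K)} :=
      isOpen_lt (by fun_prop) continuous_const
    filter_upwards [hopen.mem_nhds (show (s, y) ∈ {p : ℝ × ℝ | |p.2| < 1/(4*K)} from hy)]
      with p hp using hloc t p hp
  have hR : transOp ε m γ (φ t) (s, y) = transOp ε m γ (uOp m γ θ₀ (ψ t)) (s, y) := by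
    unfold transOp pdx pdy
    rw [hev.fderiv_eq, hev.eq_of_nhds]
  rw [hR, ← intertwine hm hcurve θ₀ hν₀ ε (ψ t) (hu t) s y hJ]
  have hL : (fun τ => φ τ (s, y)) = fun τ => uOp m γ θ₀ (ψ τ) (s, y) :=
    funext (fun τ => hloc τ (s, y) hy)
  have hψt : HasDerivAt (fun τ => ψ τ (tubeMap m γ (s, y)))
      (deriv (fun τ => ψ τ (tubeMap m γ (s, y))) t) t := by
    have : ContDiff ℝ (⊤ : ℕ∞) (fun τ => ψ τ (tubeMap m γ (s, y))) :=
      hψ.smooth.comp (contDiff_id.prodMk contDiff_const)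
    exact (this.differentiable (by simp) t).hasDerivAt
  have hd := hasDeriv_line _ _ _ _ _ _ t
    (hasDerivAt_const t (Real.sqrt ((1 - y * curv m γ s)/2)))
    (hasDerivAt_const t (thetaFun m γ θ₀ s)) hψt
  have hd' : deriv (fun τ => uOp m γ θ₀ (ψ τ) (s, y)) t = _ := hd.deriv
  rw [hL, hd']
  unfold uOp
  simp only
  rw [← hψ.eqn t (tubeMap m γ (s, y)), Matrix.mulVec_smul]
  simp
  constructor <;> ring
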